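/- Let G be a group, let x ∈ G, let H be a nilpotent normal subgroup of G, and let Y ⊆ G be a subset of H with H = ⟨Y⟩ (the subgroup generated by Y), such that G is generated by {x} together with H. Suppose there exists an integer n ≥ 1 such that the n-fold iterate ad_x^[n] sends every element of Y to the identity. Then G is nilpotent. -/

import Mathlib

/-- For an element `x` of a group `G`, `adMap x h = [x, h] = x⁻¹ * h⁻¹ * x * h`. -/
def adMap {G : Type*} [Group G] (x : G) : G → G := fun h => x⁻¹ * h⁻¹ * x * h

namespace Subgroup

open scoped commutatorElement

variable {G : Type*} [Group G]

/-- The iterated commutator `⁅⋯⁅⁅K, G⁆, G⁆⋯, G⁆` with `m` copies of the ambient group `G`. -/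
def iterCommutatorTop (K : Subgroup G) : ℕ → Subgroup G
  | 0 => K
  | m + 1 => iterCommutatorTop ⁅K, ⊤⁆ m

theorem iterCommutatorTop_mono {K L : Subgroup G} (h : K ≤ L) (m : ℕ) :
    K.iterCommutatorTop m ≤ L.iterCommutatorTop m := by
  induction m generalizing K L with
  | zero => exact h
  | succ m ih => exact ih (commutator_mono h le_rfl)

theorem iterCommutatorTop_le {K : Subgroup G} [hK : K.Normal] (m : ℕ) :
    K.iterCommutatorTop m ≤ K := by
  induction m with
  | zero => exact le_rfl
  | succ m ih => exact (iterCommutatorTop_mono (commutator_le_left K ⊤) m).trans ih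

theorem iterCommutatorTop_add (K : Subgroup G) (m n : ℕ) :
    K.iterCommutatorTop (m + n) = (K.iterCommutatorTop m).iterCommutatorTop n := by
  induction m generalizing K with
  | zero => simp [iterCommutatorTop]
  | succ m ih => rw [Nat.succ_add]; exact ih _

theorem iterCommutatorTop_one (K : Subgroup G) : K.iterCommutatorTop 1 = ⁅K, ⊤⁆ := rfl

theorem lowerCentralSeries_top_eq_iterCommutatorTop (m : ℕ) :
    (⊤ : Subgroup G).lowerCentralSeries m = (⊤ : Subgroup G).iterCommutatorTop m := by
  induction m with
  | zero => rfl
  | succ m ih => rw [iterCommutatorTop_add, lowerCentralSeries_succ, ih, iterCommutatorTop_one]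

theorem commutator_le_iff_map_mk'_eq_bot (A B N : Subgroup G) [N.Normal] :
    ⁅A, B⁆ ≤ N ↔ ⁅A.map (QuotientGroup.mk' N), B.map (QuotientGroup.mk' N)⁆ = ⊥ := by
  rw [← map_commutator, map_eq_bot_iff, QuotientGroup.ker_mk']

theorem commutator_closure_le {S T : Set G} {N : Subgroup G} [N.Normal]
    (h : ∀ s ∈ S, ∀ t ∈ T, ⁅s, t⁆ ∈ N) : ⁅closure S, closure T⁆ ≤ N := by
  rw [commutator_le_iff_map_mk'_eq_bot, commutator_eq_bot_iff_le_centralizer,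
    MonoidHom.map_closure, MonoidHom.map_closure, centralizer_closure, closure_le]
  rintro _ ⟨s, hs, rfl⟩
  rw [SetLike.mem_coe, mem_centralizer_iff_commutator_eq_one]
  rintro _ ⟨t, ht, rfl⟩
  rw [← map_commutatorElement, ← MonoidHom.mem_ker, QuotientGroup.ker_mk',
    ← commutatorElement_inv]
  exact N.inv_mem (h s hs t ht)

theorem sup_commutator_le {A B C N : Subgroup G} [N.Normal] (hA : ⁅A, C⁆ ≤ N) (hB : ⁅B, C⁆ ≤ N) :
    ⁅A ⊔ B, C⁆ ≤ N := by
  rw [sup_eq_closure, ← closure_eq C]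
  refine commutator_closure_le ?_
  rintro s (hs | hs) t ht
  · exact hA (commutator_mem_commutator hs ht)
  · exact hB (commutator_mem_commutator hs ht)

theorem iterCommutatorTop_sup_le {A B N : Subgroup G} [A.Normal] [B.Normal] {m : ℕ}
    (hA : A.iterCommutatorTop m ≤ N) (hB : B.iterCommutatorTop m ≤ N) :
    (A ⊔ B).iterCommutatorTop m ≤ N := by
  induction m generalizing A B with
  | zero => exact sup_le hA hB
  | succ m ih =>
    have h : ⁅A ⊔ B, ⊤⁆ ≤ ⁅A, (⊤ : Subgroup G)⁆ ⊔ ⁅B, (⊤ : Subgroup G)⁆ :=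
      sup_commutator_le le_sup_left le_sup_right
    exact (iterCommutatorTop_mono h m).trans (ih hA hB)

/-- The three subgroups lemma modulo a normal subgroup. -/
theorem commutator_commutator_le_of_rotate {A B C N : Subgroup G} [N.Normal]
    (h₁ : ⁅⁅B, C⁆, A⁆ ≤ N) (h₂ : ⁅⁅C, A⁆, B⁆ ≤ N) : ⁅⁅A, B⁆, C⁆ ≤ N := by
  rw [commutator_le_iff_map_mk'_eq_bot, map_commutator] at h₁ h₂ ⊢
  exact commutator_commutator_eq_bot_of_rotate h₁ h₂

theorem commutator_commutator_top_le (A B : Subgroup G) [A.Normal] [B.Normal] :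
    ⁅⁅A, B⁆, ⊤⁆ ≤ ⁅⁅A, (⊤ : Subgroup G)⁆, B⁆ ⊔ ⁅A, ⁅B, (⊤ : Subgroup G)⁆⁆ := by
  refine commutator_commutator_le_of_rotate ?_ ?_
  · rw [commutator_comm]; exact le_sup_right
  · rw [commutator_comm (⊤ : Subgroup G) A]; exact le_sup_left

theorem iterCommutatorTop_commutator_le {A B A' B' N : Subgroup G} [A.Normal] [B.Normal]
    [N.Normal] {m n : ℕ} (hA : A.iterCommutatorTop m ≤ A') (hB : B.iterCommutatorTop n ≤ B')
    (hA' : ⁅A', B⁆ ≤ N) (hB' : ⁅A, B'⁆ ≤ N) : ⁅A, B⁆.iterCommutatorTop (m + n) ≤ N := by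
  induction hk : m + n generalizing m n A B with
  | zero =>
    obtain rfl : m = 0 := by lia
    exact (commutator_mono hA le_rfl).trans hA'
  | succ k ih =>
    rcases m with - | m
    · exact (iterCommutatorTop_le _).trans ((commutator_mono hA le_rfl).trans hA')
    rcases n with - | n
    · exact (iterCommutatorTop_le _).trans ((commutator_mono le_rfl hB).trans hB')
    refine (iterCommutatorTop_mono (commutator_commutator_top_le A B) k).trans
      (iterCommutatorTop_sup_le ?_ ?_)
    · exact ih (m := m) (n := n + 1) hA hB hA'
        ((commutator_mono (commutator_le_left A ⊤) le_rfl).trans hB') (by lia)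
    · exact ih (m := m + 1) (n := n) hA hB
        ((commutator_mono le_rfl (commutator_le_left B ⊤)).trans hA') hB' (by lia)

theorem commutator_lowerCentralSeries_one_le (H : Subgroup G) [H.Normal] (i : ℕ) :
    ⁅H.lowerCentralSeries i, H.lowerCentralSeries 1⁆ ≤ H.lowerCentralSeries (i + 2) := by
  rw [commutator_comm]
  refine commutator_commutator_le_of_rotate ?_ le_rfl
  rw [commutator_comm H]
  exact le_rfl

theorem exists_iterCommutatorTop_lowerCentralSeries_le {H : Subgroup G} [H.Normal] {n : ℕ}
    (hn : H.iterCommutatorTop n ≤ H.lowerCentralSeries 1) (i : ℕ) :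
    ∃ m, (H.lowerCentralSeries i).iterCommutatorTop m ≤ H.lowerCentralSeries (i + 1) := by
  induction i with
  | zero => exact ⟨n, hn⟩
  | succ i ih =>
    obtain ⟨m, hm⟩ := ih
    exact ⟨m + n, iterCommutatorTop_commutator_le hm hn le_rfl
      (H.commutator_lowerCentralSeries_one_le i)⟩

theorem exists_iterCommutatorTop_le_lowerCentralSeries {H : Subgroup G} [H.Normal] {n : ℕ}
    (hn : H.iterCommutatorTop n ≤ H.lowerCentralSeries 1) (i : ℕ) :
    ∃ m, H.iterCommutatorTop m ≤ H.lowerCentralSeries i := by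
  induction i with
  | zero => exact ⟨0, le_rfl⟩
  | succ i ih =>
    obtain ⟨m, hm⟩ := ih
    obtain ⟨k, hk⟩ := exists_iterCommutatorTop_lowerCentralSeries_le hn i
    refine ⟨m + k, ?_⟩
    rw [iterCommutatorTop_add]
    exact (iterCommutatorTop_mono hm k).trans hk

/-- A variant of Hall's criterion: if `H` is a nilpotent normal subgroup and sufficiently many
commutators with `G` bring `G` into `H` and `H` into `⁅H, H⁆`, then `G` is nilpotent. -/
theorem isNilpotent_of_iterCommutatorTop_le {H : Subgroup G} [H.Normal]
    (hH : Group.IsNilpotent H) {k n : ℕ} (hk : (⊤ : Subgroup G).iterCommutatorTop k ≤ H)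
    (hn : H.iterCommutatorTop n ≤ H.lowerCentralSeries 1) : Group.IsNilpotent G := by
  obtain ⟨c, hc⟩ := H.isNilpotent_iff_lowerCentralSeries.mp hH
  obtain ⟨m, hm⟩ := exists_iterCommutatorTop_le_lowerCentralSeries hn c
  refine nilpotent_iff_lowerCentralSeries.mpr ⟨k + m, ?_⟩
  rw [lowerCentralSeries_top_eq_iterCommutatorTop, iterCommutatorTop_add, eq_bot_iff, ← hc]
  exact (iterCommutatorTop_mono hk m).trans hm

theorem commutator_top_le_of_closure_insert_eq_top {x : G} {H : Subgroup G} [H.Normal]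
    (hgen : closure ({x} ∪ (H : Set G)) = ⊤) : ⁅(⊤ : Subgroup G), ⊤⁆ ≤ H := by
  rw [← hgen]
  refine commutator_closure_le ?_
  rintro s (rfl | hs) t (rfl | ht)
  · simp
  · exact commutator_le_right ⊤ H (commutator_mem_commutator (mem_top _) ht)
  all_goals exact commutator_le_left H ⊤ (commutator_mem_commutator hs (mem_top _))

theorem adMap_eq_commutatorElement (x h : G) : adMap x h = ⁅x⁻¹, h⁻¹⁆ := by
  simp [adMap, commutatorElement_def]

theorem adMap_one (x : G) : adMap x 1 = 1 := by simp [adMap]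

theorem commutatorElement_mem_of_adMap_mem {x h : G} {N : Subgroup G} [hN : N.Normal]
    (hx : adMap x h ∈ N) : ⁅h, x⁆ ∈ N := by
  have := N.inv_mem (hN.conj_mem _ hx (x * h))
  convert this using 1
  simp [adMap, commutatorElement_def, mul_assoc]

theorem adMap_iterate_mem {x h : G} {H : Subgroup G} [H.Normal] (hh : h ∈ H) (k : ℕ) :
    (adMap x)^[k] h ∈ H := by
  induction k with
  | zero => exact hh
  | succ k ih =>
    rw [Function.iterate_succ_apply', adMap_eq_commutatorElement]
    exact commutator_le_right ⊤ H (commutator_mem_commutator (mem_top _) (H.inv_mem ih))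

/-- The subgroup generated by `⁅H, H⁆` and the images of `Y` under all iterates of `adMap x` of
order at least `j`. -/
def adFiltration (x : G) (H : Subgroup G) (Y : Set G) (j : ℕ) : Subgroup G :=
  closure ((H.lowerCentralSeries 1 : Set G) ∪ {g | ∃ k, j ≤ k ∧ ∃ y ∈ Y, (adMap x)^[k] y = g})

theorem adFiltration_anti (x : G) (H : Subgroup G) (Y : Set G) : Antitone (adFiltration x H Y) :=
  fun _ _ hij => Subgroup.closure_mono <| Set.union_subset_union_right _
    fun _ ⟨k, hk, hy⟩ => ⟨k, hij.trans hk, hy⟩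

theorem lowerCentralSeries_one_le_adFiltration (x : G) (H : Subgroup G) (Y : Set G) (j : ℕ) :
    H.lowerCentralSeries 1 ≤ adFiltration x H Y j :=
  fun _ hg => Subgroup.subset_closure (Or.inl hg)

theorem adFiltration_le_lowerCentralSeries_one {x : G} {H : Subgroup G} {Y : Set G} {n : ℕ}
    (hn : ∀ y ∈ Y, (adMap x)^[n] y = 1) : adFiltration x H Y n ≤ H.lowerCentralSeries 1 := by
  refine (closure_le _).mpr (Set.union_subset le_rfl ?_)
  rintro _ ⟨k, hk, y, hy, rfl⟩
  obtain ⟨d, rfl⟩ := Nat.exists_eq_add_of_le' hk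
  rw [Function.iterate_add_apply, hn y hy, Function.iterate_fixed (adMap_one x)]
  exact one_mem _

theorem commutator_adFiltration_top_le {x : G} {H : Subgroup G} [H.Normal] {Y : Set G}
    (hYH : Y ⊆ H) (hgen : closure ({x} ∪ (H : Set G)) = ⊤) {j : ℕ}
    (hN : (adFiltration x H Y (j + 1)).Normal) :
    ⁅adFiltration x H Y j, ⊤⁆ ≤ adFiltration x H Y (j + 1) := by
  rw [← hgen]
  refine commutator_closure_le ?_
  rintro s (hs | ⟨k, hk, y, hy, rfl⟩) t ht
  · exact lowerCentralSeries_one_le_adFiltration x H Y _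
      (commutator_le_left _ ⊤ (commutator_mem_commutator hs (mem_top t)))
  · rcases ht with rfl | ht
    · refine commutatorElement_mem_of_adMap_mem (Subgroup.subset_closure (Or.inr ?_))
      exact ⟨k + 1, by lia, y, hy, Function.iterate_succ_apply' _ _ _⟩
    · exact lowerCentralSeries_one_le_adFiltration x H Y _
        (commutator_mem_commutator (adMap_iterate_mem (hYH hy) k) ht)

theorem adFiltration_normal {x : G} {H : Subgroup G} [H.Normal] {Y : Set G} (hYH : Y ⊆ H)
    (hgen : closure ({x} ∪ (H : Set G)) = ⊤) {n : ℕ} (hn : ∀ y ∈ Y, (adMap x)^[n] y = 1)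
    {j : ℕ} (hj : j ≤ n) : (adFiltration x H Y j).Normal := by
  induction hj using Nat.decreasingInduction with
  | self =>
    rw [(adFiltration_le_lowerCentralSeries_one hn).antisymm
      (lowerCentralSeries_one_le_adFiltration x H Y n)]
    infer_instance
  | of_succ j _ ih =>
    exact commutator_top_right_le_iff.mp <| (commutator_adFiltration_top_le hYH hgen ih).trans
      (adFiltration_anti x H Y j.le_succ)

theorem iterCommutatorTop_le_adFiltration {x : G} {H : Subgroup G} [H.Normal] {Y : Set G}
    (hY : closure Y = H) (hgen : closure ({x} ∪ (H : Set G)) = ⊤) {n : ℕ}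
    (hn : ∀ y ∈ Y, (adMap x)^[n] y = 1) {j : ℕ} (hj : j ≤ n) :
    H.iterCommutatorTop j ≤ adFiltration x H Y j := by
  induction j with
  | zero =>
    refine hY.symm.le.trans (Subgroup.closure_mono fun y hy => Or.inr ?_)
    exact ⟨0, le_rfl, y, hy, rfl⟩
  | succ j ih =>
    have hYH : Y ⊆ H := hY ▸ Subgroup.subset_closure
    rw [iterCommutatorTop_add, iterCommutatorTop_one]
    exact (commutator_mono (ih (by lia)) le_rfl).trans
      (commutator_adFiltration_top_le hYH hgen (adFiltration_normal hYH hgen hn hj))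

end Subgroup

/-- If `G = ⟨x, H⟩` with `H` a nilpotent normal subgroup generated by a set `Y`, and some
iterate of `adMap x` kills every element of `Y`, then `G` is nilpotent. -/
theorem nilpotency_from_ad {G : Type*} [Group G] (x : G) (H : Subgroup G)
    (hHnormal : H.Normal) (hHnilp : Group.IsNilpotent H) (Y : Set G) (hYH : Y ⊆ (H : Set G))
    (hgenH : Subgroup.closure Y = H)
    (hgenG : Subgroup.closure ({x} ∪ (H : Set G)) = ⊤)
    (hn : ∃ n, 1 ≤ n ∧ ∀ y ∈ Y, (adMap x)^[n] y = 1) :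
    Group.IsNilpotent G := by
  obtain ⟨n, -, hn⟩ := hn
  exact Subgroup.isNilpotent_of_iterCommutatorTop_le hHnilp (k := 1)
    (Subgroup.commutator_top_le_of_closure_insert_eq_top hgenG)
    ((Subgroup.iterCommutatorTop_le_adFiltration hgenH hgenG hn le_rfl).trans
      (Subgroup.adFiltration_le_lowerCentralSeries_one hn))
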